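/- arXiv:1807.10468 — 2 statements merged into one kernel-verified Lean document; each statement's English description precedes it below -/
import Mathlib

section
/- For the game CSG({1,...,N}) with N ≥ 3, and nonnegative integers k, ℓ with k, ℓ ≤ N−1: the Grundy value of the subdivided star S(1,k,ℓ) equals k+ℓ if k+ℓ ≤ N−2 and both k and ℓ are odd; equals k+1 if k+ℓ ≤ N−2 and k = ℓ ≠ 0 is even; and equals (k+ℓ+2) mod (N+1) otherwise. -/
open SimpleGraph

/-- The minimum excludant of a set of naturals. -/
noncomputable def mex (s : Set ℕ) : ℕ := sInf {n | n ∉ s}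

/-- The graph induced on a set of vertices is connected. -/
def ConnOn {V : Type*} (G : SimpleGraph V) (s : Set V) : Prop := (G.induce s).Connected

/-- A legal move in the connected subtraction game CSG(L) on the graph `G`:
from remaining vertex set `s`, remove the (nonempty) connected set `s \ t` whose
cardinality lies in `L`, leaving `t`, which must be empty or induce a connected graph. -/
def CsgMove {V : Type*} [DecidableEq V] (G : SimpleGraph V) (L : Set ℕ)
    (s t : Finset V) : Prop :=
  t ⊆ s ∧ (s \ t).Nonempty ∧ (s \ t).card ∈ L ∧
    ConnOn G (↑(s \ t) : Set V) ∧ (t = ∅ ∨ ConnOn G (↑t : Set V))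

/-- The Grundy value of the position with remaining vertex set `s` in the game
CSG(L) played on `G`, defined by the mex recursion over all legal moves. -/
noncomputable def csgGrundy {V : Type*} [DecidableEq V] (G : SimpleGraph V) (L : Set ℕ)
    (s : Finset V) : ℕ :=
  mex (Set.range fun t : {t : Finset V // CsgMove G L s t} =>
    have : t.1.card < s.card := by
      obtain ⟨x, hx⟩ := t.2.2.1
      rw [Finset.mem_sdiff] at hx
      exact Finset.card_lt_card ((Finset.ssubset_iff_of_subset t.2.1).2 ⟨x, hx.1, hx.2⟩)
    csgGrundy G L t.1)
termination_by s.card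
decreasing_by exact this

/-- The subdivided star with `t` branches of lengths `l 0, …, l (t-1)` appended
to a central vertex `none`. -/
def subdividedStar {t : ℕ} (l : Fin t → ℕ) :
    SimpleGraph (Option (Σ i : Fin t, Fin (l i))) :=
  SimpleGraph.fromRel fun a b =>
    match a, b with
    | none, some ⟨_, j⟩ => (j : ℕ) = 0
    | some ⟨i, j⟩, some ⟨i', j'⟩ => (i : ℕ) = (i' : ℕ) ∧ (j : ℕ) + 1 = (j' : ℕ)
    | _, _ => False

/-- The graph `G` with a path on `k` new vertices appended at the vertex `u`. -/
def appendPath {V : Type*} (G : SimpleGraph V) (u : V) (k : ℕ) :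
    SimpleGraph (V ⊕ Fin k) :=
  SimpleGraph.fromRel fun a b =>
    match a, b with
    | Sum.inl x, Sum.inl y => G.Adj x y
    | Sum.inl x, Sum.inr j => x = u ∧ (j : ℕ) = 0
    | Sum.inr j, Sum.inr j' => (j : ℕ) + 1 = (j' : ℕ)
    | _, _ => False

lemma mex_eq {s : Set ℕ} {g : ℕ} (hg : g ∉ s) (h : ∀ v < g, v ∈ s) : mex s = g :=
  le_antisymm (Nat.sInf_le hg) (le_csInf ⟨g, hg⟩ fun v hv => not_lt.1 fun hlt => hv (h v hlt))

section General

variable {V W : Type*} {G : SimpleGraph V} {H : SimpleGraph W}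

lemma csgGrundy_eq_of [DecidableEq V] {L : Set ℕ} {s : Finset V} {g : ℕ}
    (h₁ : ∀ t, CsgMove G L s t → csgGrundy G L t ≠ g)
    (h₂ : ∀ v < g, ∃ t, CsgMove G L s t ∧ csgGrundy G L t = v) : csgGrundy G L s = g := by
  rw [csgGrundy]
  refine mex_eq ?_ fun v hv => ?_
  · rintro ⟨⟨t, ht⟩, h⟩
    exact h₁ t ht h
  · obtain ⟨t, ht, h⟩ := h₂ v hv
    exact ⟨⟨t, ht⟩, h⟩

lemma connOn_image (f : G ↪g H) (s : Set V) : ConnOn H (f '' s) ↔ ConnOn G s := by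
  let e : G.induce s ≃g H.induce (f '' s) :=
    { toEquiv := Equiv.Set.image f s f.injective
      map_rel_iff' := by
        intro a b
        exact f.map_adj_iff }
  exact e.connected_iff.symm

lemma csgMove_map [DecidableEq V] [DecidableEq W] (f : G ↪g H) (L : Set ℕ) (s t : Finset V) :
    CsgMove H L (s.map f.toEmbedding) (t.map f.toEmbedding) ↔ CsgMove G L s t := by
  have hc (u : Finset V) : ConnOn H (↑(u.map f.toEmbedding) : Set W) ↔ ConnOn G (↑u : Set V) := by
    rw [Finset.coe_map]
    exact connOn_image f u
  have hd : s.map f.toEmbedding \ t.map f.toEmbedding = (s \ t).map f.toEmbedding := by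
    ext x
    simp only [Finset.mem_sdiff, Finset.mem_map]
    constructor
    · rintro ⟨⟨a, ha, rfl⟩, h⟩
      exact ⟨a, ⟨ha, fun hat => h ⟨a, hat, rfl⟩⟩, rfl⟩
    · rintro ⟨a, ⟨ha, hat⟩, rfl⟩
      refine ⟨⟨a, ha, rfl⟩, ?_⟩
      rintro ⟨b, hb, hba⟩
      exact hat (f.injective hba ▸ hb)
  simp only [CsgMove, hd, hc, Finset.map_subset_map, Finset.map_nonempty, Finset.card_map,
    Finset.map_eq_empty]

lemma csgGrundy_map [DecidableEq V] [DecidableEq W] (f : G ↪g H) (L : Set ℕ) (s : Finset V) :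
    csgGrundy G L s = csgGrundy H L (s.map f.toEmbedding) := by
  induction hn : s.card using Nat.strong_induction_on generalizing s with
  | _ n ih =>
  have ih' (t : Finset V) (ht : CsgMove G L s t) :
      csgGrundy G L t = csgGrundy H L (t.map f.toEmbedding) := by
    refine ih t.card ?_ t rfl
    rw [← hn]
    obtain ⟨x, hx⟩ := ht.2.1
    rw [Finset.mem_sdiff] at hx
    exact Finset.card_lt_card ((Finset.ssubset_iff_of_subset ht.1).2 ⟨x, hx.1, hx.2⟩)
  rw [csgGrundy, csgGrundy]
  congr 1
  ext v
  constructor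
  · rintro ⟨⟨t, ht⟩, h⟩
    exact ⟨⟨t.map f.toEmbedding, (csgMove_map f L s t).2 ht⟩, (ih' t ht).symm.trans h⟩
  · rintro ⟨⟨t', ht'⟩, h⟩
    obtain ⟨t, -, rfl⟩ := Finset.subset_map_iff.1 ht'.1
    have ht := (csgMove_map f L s t).1 ht'
    exact ⟨⟨t, ht⟩, (ih' t ht).trans h⟩

/-- A set closed under adjacency within a connected set contains all of it. -/
lemma ConnOn.closed {s : Set V} (hs : ConnOn G s) (P : V → Prop)
    (hP : ∀ u ∈ s, ∀ v ∈ s, G.Adj u v → P u → P v) {x y : V} (hx : x ∈ s) (hy : y ∈ s)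
    (h : P x) : P y := by
  obtain ⟨w⟩ := hs.preconnected ⟨x, hx⟩ ⟨y, hy⟩
  have key : ∀ a b : s, (G.induce s).Walk a b → P a → P b := by
    intro a b w
    induction w with
    | nil => exact id
    | cons hadj _ ih => exact fun ha => ih (hP _ (Subtype.prop _) _ (Subtype.prop _) hadj ha)
  exact key _ _ w h

/-- A set is connected if every vertex other than the root has a neighbour of smaller rank. -/
lemma connOn_of_rank {s : Set V} (r : V) (hr : r ∈ s) (μ : V → ℕ)
    (h : ∀ v ∈ s, v ≠ r → ∃ u ∈ s, G.Adj v u ∧ μ u < μ v) : ConnOn G s := by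
  have key : ∀ n, ∀ v (hv : v ∈ s), μ v = n → (G.induce s).Reachable ⟨v, hv⟩ ⟨r, hr⟩ := by
    intro n
    induction n using Nat.strong_induction_on with
    | _ n ih =>
    intro v hv hn
    by_cases hvr : v = r
    · subst hvr
      rfl
    · obtain ⟨u, hu, hadj, hlt⟩ := h v hv hvr
      have hadj' : (G.induce s).Adj ⟨v, hv⟩ ⟨u, hu⟩ := hadj
      exact hadj'.reachable.trans (ih _ (hn ▸ hlt) u hu rfl)
  have : Nonempty s := ⟨⟨r, hr⟩⟩
  exact ⟨fun a b => (key _ a a.2 rfl).trans (key _ b b.2 rfl).symm⟩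

lemma csgMove_of_sdiff_eq [DecidableEq V] {N : ℕ} {s t u : Finset V} (hts : t ⊆ s)
    (hu : s \ t = u) (hcu : ConnOn G (↑u : Set V)) (hN : u.card ≤ N)
    (ht : t = ∅ ∨ ConnOn G (↑t : Set V)) : CsgMove G (Set.Icc 1 N) s t := by
  subst hu
  obtain ⟨x⟩ := hcu.nonempty
  have hne : (s \ t).Nonempty := ⟨x.1, x.2⟩
  exact ⟨hts, hne, ⟨hne.card_pos, hN⟩, hcu, ht⟩

end General

/-- The bi-infinite path on `ℤ` with one extra leaf `none` attached at `0`. -/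
def spider : SimpleGraph (Option ℤ) :=
  SimpleGraph.fromRel fun a b =>
    match a, b with
    | none, some i => i = 0
    | some i, some j => i + 1 = j
    | _, _ => False

lemma spider_adj_some_some (i j : ℤ) :
    spider.Adj (some i) (some j) ↔ i + 1 = j ∨ j + 1 = i := by
  simp only [spider, SimpleGraph.fromRel_adj, ne_eq, Option.some.injEq]
  omega

lemma spider_adj_none_some (i : ℤ) : spider.Adj none (some i) ↔ i = 0 := by
  simp [spider]

lemma spider_adj_some_none (i : ℤ) : spider.Adj (some i) none ↔ i = 0 := by
  rw [SimpleGraph.adj_comm, spider_adj_none_some]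

/-- The vertices `a, …, b - 1` of the long path of `spider`. -/
noncomputable def seg (a b : ℤ) : Finset (Option ℤ) := (Finset.Ico a b).map Function.Embedding.some

/-- The copy of `S(1, a, b)` centred at `0` in `spider`. -/
noncomputable def tee (a b : ℕ) : Finset (Option ℤ) := insert none (seg (-a) (b + 1))

@[simp] lemma none_mem_seg (a b : ℤ) : none ∉ seg a b := by simp [seg]

@[simp] lemma some_mem_seg (a b i : ℤ) : some i ∈ seg a b ↔ a ≤ i ∧ i < b := by simp [seg]

@[simp] lemma none_mem_tee (a b : ℕ) : none ∈ tee a b := by simp [tee]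

@[simp] lemma some_mem_tee (a b : ℕ) (i : ℤ) : some i ∈ tee a b ↔ -(a : ℤ) ≤ i ∧ i ≤ b := by
  simp [tee]

@[simp] lemma card_seg (a b : ℤ) : (seg a b).card = (b - a).toNat := by simp [seg]

@[simp] lemma card_tee (a b : ℕ) : (tee a b).card = a + b + 2 := by
  rw [tee, Finset.card_insert_of_notMem (none_mem_seg _ _), card_seg]
  omega

lemma seg_eq_empty {a b : ℤ} (h : b ≤ a) : seg a b = ∅ := by
  simp [seg, h]

lemma connOn_seg {a b : ℤ} (h : a < b) : ConnOn spider (↑(seg a b) : Set (Option ℤ)) := by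
  refine connOn_of_rank (some a) (by simpa using h) (fun v => ((v.getD a) - a).toNat) ?_
  rintro (_ | i) hv hne
  · simp at hv
  · simp only [Finset.mem_coe, some_mem_seg, ne_eq, Option.some.injEq] at hv hne
    refine ⟨some (i - 1), ?_, ?_, ?_⟩
    · simp only [Finset.mem_coe, some_mem_seg]
      omega
    · rw [spider_adj_some_some]
      omega
    · simp only [Option.getD_some]
      omega

lemma connOn_tee (a b : ℕ) : ConnOn spider (↑(tee a b) : Set (Option ℤ)) := by
  refine connOn_of_rank (some 0) (by simp) (fun v => (v.getD 1).natAbs) ?_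
  rintro (_ | i) hv hne
  · exact ⟨some 0, by simp, by simp [spider_adj_none_some], by simp⟩
  · simp only [Finset.mem_coe, some_mem_tee, ne_eq, Option.some.injEq] at hv hne
    rcases lt_or_gt_of_ne hne with hi | hi
    · refine ⟨some (i + 1), ?_, ?_, ?_⟩
      · simp only [Finset.mem_coe, some_mem_tee]
        omega
      · rw [spider_adj_some_some]
        omega
      · simp only [Option.getD_some]
        omega
    · refine ⟨some (i - 1), ?_, ?_, ?_⟩
      · simp only [Finset.mem_coe, some_mem_tee]
        omega
      · rw [spider_adj_some_some]
        omega
      · simp only [Option.getD_some]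
        omega

lemma connOn_singleton_none : ConnOn spider (↑({none} : Finset (Option ℤ)) : Set (Option ℤ)) := by
  refine connOn_of_rank none (by simp) (fun _ => 0) ?_
  intro v hv hne
  simp only [Finset.coe_singleton, Set.mem_singleton_iff] at hv
  exact absurd hv hne

lemma ConnOn.some_mem_of_mem {s : Set (Option ℤ)} (hs : ConnOn spider s) {x y z : ℤ}
    (hx : some x ∈ s) (hz : some z ∈ s) (hxy : x ≤ y) (hyz : y ≤ z) : some y ∈ s := by
  by_contra hy
  have hxy' : x ≠ y := fun h => hy (h ▸ hx)
  have hyz' : z ≠ y := fun h => hy (h ▸ hz)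
  have key := hs.closed (fun v => v.getD 0 < y) ?_ hx hz
    (show x < y by omega)
  · change z < y at key
    omega
  · rintro (_ | u) hu (_ | v) hv hadj h
    · exact h
    · rw [spider_adj_none_some] at hadj
      exact hadj ▸ h
    · rw [spider_adj_some_none] at hadj
      exact hadj ▸ h
    · rw [spider_adj_some_some] at hadj
      have hvy : v ≠ y := fun h => hy (h ▸ hv)
      simp only [Option.getD_some] at h ⊢
      omega

lemma ConnOn.zero_mem {s : Set (Option ℤ)} (hs : ConnOn spider s) {x : ℤ}
    (hn : none ∈ s) (hx : some x ∈ s) : some 0 ∈ s := by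
  by_contra h0
  have key := hs.closed (fun v => v = none) ?_ hn hx rfl
  · simp at key
  · rintro u hu (_ | v) hv hadj rfl
    · rfl
    · rw [spider_adj_none_some] at hadj
      exact absurd (hadj ▸ hv) h0

lemma connOn_spider_cases {t : Finset (Option ℤ)} (ht : ConnOn spider (↑t : Set (Option ℤ))) :
    t = {none} ∨ (∃ a b, a < b ∧ t = seg a b) ∨ ∃ a b, t = tee a b := by
  by_cases hne : t.eraseNone.Nonempty
  · obtain ⟨m, hmin, hle⟩ : ∃ m, some m ∈ t ∧ ∀ i, some i ∈ t → m ≤ i :=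
      ⟨_, Finset.mem_eraseNone.1 (t.eraseNone.min'_mem hne),
        fun i hi => t.eraseNone.min'_le i (Finset.mem_eraseNone.2 hi)⟩
    obtain ⟨M, hmax, hge⟩ : ∃ M, some M ∈ t ∧ ∀ i, some i ∈ t → i ≤ M :=
      ⟨_, Finset.mem_eraseNone.1 (t.eraseNone.max'_mem hne),
        fun i hi => t.eraseNone.le_max' i (Finset.mem_eraseNone.2 hi)⟩
    have hmem (i : ℤ) : some i ∈ t ↔ m ≤ i ∧ i ≤ M :=
      ⟨fun h => ⟨hle i h, hge i h⟩, fun h => ht.some_mem_of_mem hmin hmax h.1 h.2⟩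
    have hmM := hle M hmax
    right
    by_cases hn : none ∈ t
    · right
      have h0 := (hmem 0).1 (ht.zero_mem hn hmin)
      refine ⟨(-m).toNat, M.toNat, ?_⟩
      ext (_ | i)
      · simp [hn]
      · rw [hmem, some_mem_tee]
        omega
    · left
      refine ⟨m, M + 1, by omega, ?_⟩
      ext (_ | i)
      · simp [hn]
      · rw [hmem, some_mem_seg]
        omega
  · left
    obtain ⟨⟨v, hv⟩⟩ := ht.nonempty
    have hsome (i : ℤ) : some i ∉ t := fun hi => hne ⟨i, Finset.mem_eraseNone.2 hi⟩
    have hn : none ∈ t := by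
      cases v with
      | none => exact hv
      | some i => exact absurd hv (hsome i)
    ext (_ | i)
    · simp [hn]
    · simp [hsome]

lemma mod_ne_of_lt {N m n : ℕ} (h : m < n) (hN : n ≤ m + N) : m % (N + 1) ≠ n % (N + 1) := by
  intro h'
  have hd := (Nat.modEq_iff_dvd' h.le).1 h'
  have := Nat.le_of_dvd (by omega) hd
  omega

lemma csgGrundy_empty (N : ℕ) : csgGrundy spider (Set.Icc 1 N) ∅ = 0 := by
  refine csgGrundy_eq_of (fun t ht => ?_) (by simp)
  simpa using ht.2.1

lemma csgGrundy_singleton_none {N : ℕ} (hN : 1 ≤ N) :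
    csgGrundy spider (Set.Icc 1 N) {none} = 1 := by
  refine csgGrundy_eq_of (fun t ht => ?_) fun v hv => ?_
  · have : t = ∅ := by
      rcases Finset.subset_singleton_iff.1 ht.1 with h | h
      · exact h
      · simpa [h] using ht.2.1
    rw [this, csgGrundy_empty]
    exact zero_ne_one
  · refine ⟨∅, csgMove_of_sdiff_eq (by simp) (Finset.sdiff_empty) connOn_singleton_none
      (by simpa using hN) (Or.inl rfl), ?_⟩
    rw [csgGrundy_empty]
    omega

/-- A move on a path leaves a shorter path. -/
lemma CsgMove.of_seg {N : ℕ} {a b : ℤ} {t : Finset (Option ℤ)}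
    (h : CsgMove spider (Set.Icc 1 N) (seg a b) t) :
    ∃ c d, t = seg c d ∧ (d - c).toNat < (b - a).toNat ∧ (b - a).toNat ≤ (d - c).toNat + N := by
  obtain ⟨hts, hne, ⟨-, hcard⟩, -, ht⟩ := h
  have hpos := hne.card_pos
  have hs := Finset.card_sdiff_add_card_eq_card hts
  rw [card_seg] at hs
  have key : ∃ c d, t = seg c d := by
    rcases ht with rfl | ht
    · exact ⟨0, 0, (seg_eq_empty le_rfl).symm⟩
    · rcases connOn_spider_cases ht with rfl | ⟨c, d, -, rfl⟩ | ⟨c, d, rfl⟩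
      · exact absurd (hts (Finset.mem_singleton_self _)) (none_mem_seg _ _)
      · exact ⟨c, d, rfl⟩
      · exact absurd (hts (none_mem_tee _ _)) (none_mem_seg _ _)
  obtain ⟨c, d, rfl⟩ := key
  rw [card_seg] at hs
  exact ⟨c, d, rfl, by omega, by omega⟩

lemma csgMove_seg {N : ℕ} {a b c : ℤ} (hac : a ≤ c) (hcb : c < b) (hN : b ≤ c + N) :
    CsgMove spider (Set.Icc 1 N) (seg a b) (seg a c) := by
  refine csgMove_of_sdiff_eq (u := seg c b) ?_ ?_ (connOn_seg hcb) ?_ ?_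
  · rintro (_ | i) hi
    · simp at hi
    · rw [some_mem_seg] at hi ⊢
      omega
  · ext (_ | i)
    · simp
    · simp only [Finset.mem_sdiff, some_mem_seg]
      omega
  · rw [card_seg]
    omega
  · rcases hac.eq_or_lt with h | h
    · exact Or.inl (seg_eq_empty h.ge)
    · exact Or.inr (connOn_seg h)

lemma csgGrundy_seg (N : ℕ) (a b : ℤ) :
    csgGrundy spider (Set.Icc 1 N) (seg a b) = (b - a).toNat % (N + 1) := by
  induction hn : (b - a).toNat using Nat.strong_induction_on generalizing a b with
  | _ n ih =>
  refine csgGrundy_eq_of (fun t ht => ?_) fun v hv => ?_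
  · obtain ⟨c, d, rfl, hlt, hle⟩ := ht.of_seg
    rw [hn] at hlt hle
    rw [ih _ hlt c d rfl]
    exact mod_ne_of_lt hlt hle
  · have hmod : n % (N + 1) < N + 1 := Nat.mod_lt n (Nat.succ_pos N)
    have hdiv := Nat.div_add_mod n (N + 1)
    have hv' : ((N + 1) * (n / (N + 1)) + v) % (N + 1) = v := by
      rw [Nat.mul_add_mod, Nat.mod_eq_of_lt (by omega)]
    generalize (N + 1) * (n / (N + 1)) = q at hdiv hv'
    generalize n % (N + 1) = r at hv hdiv hmod
    refine ⟨seg a (a + (q + v : ℕ)), csgMove_seg (by omega) (by omega) (by omega), ?_⟩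
    rw [ih (q + v) (by omega) _ _ (by omega), hv']

/-- A move on `S(1, a, b)` empties it, leaves a path, or shortens one of the long branches. -/
lemma CsgMove.of_tee {N a b : ℕ} {t : Finset (Option ℤ)}
    (h : CsgMove spider (Set.Icc 1 N) (tee a b) t) :
    (t = ∅ ∧ a + b + 2 ≤ N) ∨ (t = {none} ∧ a + b + 1 ≤ N) ∨ t = seg (-a) (b + 1) ∨
      (∃ c d, t = seg c d ∧ c < d ∧ ((d - c).toNat ≤ a ∨ (d - c).toNat ≤ b) ∧
        a + b + 2 ≤ (d - c).toNat + N) ∨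
      (∃ a' < a, t = tee a' b) ∨ ∃ b' < b, t = tee a b' := by
  obtain ⟨hts, hne, ⟨-, hcard⟩, hconn, ht⟩ := h
  have hpos := hne.card_pos
  have hs := Finset.card_sdiff_add_card_eq_card hts
  rw [card_tee] at hs
  rcases ht with rfl | ht
  · rw [Finset.card_empty] at hs
    exact Or.inl ⟨rfl, by omega⟩
  rcases connOn_spider_cases ht with rfl | ⟨c, d, hcd, rfl⟩ | ⟨a', b', rfl⟩
  · rw [Finset.card_singleton] at hs
    exact Or.inr (Or.inl ⟨rfl, by omega⟩)
  · rw [card_seg] at hs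
    have hc := hts ((some_mem_seg c d c).2 (by omega))
    have hd := hts ((some_mem_seg c d (d - 1)).2 (by omega))
    rw [some_mem_tee] at hc hd
    right; right
    by_cases hfull : c = -a ∧ d = b + 1
    · obtain ⟨rfl, rfl⟩ := hfull
      exact Or.inl rfl
    · right; left
      have hn : none ∈ (↑(tee a b \ seg c d) : Set (Option ℤ)) := by simp
      have h0 : some 0 ∈ (↑(tee a b \ seg c d) : Set (Option ℤ)) := by
        by_cases hca : c = -a
        · refine hconn.zero_mem (x := b) hn ?_
          simp only [Finset.mem_coe, Finset.mem_sdiff, some_mem_tee, some_mem_seg]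
          omega
        · refine hconn.zero_mem (x := -a) hn ?_
          simp only [Finset.mem_coe, Finset.mem_sdiff, some_mem_tee, some_mem_seg]
          omega
      simp only [Finset.mem_coe, Finset.mem_sdiff, some_mem_tee, some_mem_seg] at h0
      exact ⟨c, d, rfl, hcd, by omega, by omega⟩
  · rw [card_tee] at hs
    have ha := hts ((some_mem_tee a' b' (-a')).2 (by omega))
    have hb := hts ((some_mem_tee a' b' b').2 (by omega))
    rw [some_mem_tee] at ha hb
    right; right; right; right
    by_cases hab : a' = a ∨ b' = b
    · rcases hab with rfl | rfl
      · exact Or.inr ⟨b', by omega, rfl⟩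
      · exact Or.inl ⟨a', by omega, rfl⟩
    · exfalso
      have h0 := hconn.some_mem_of_mem (x := -a) (y := 0) (z := b) ?_ ?_ (by omega) (by omega)
      · simp at h0
      · simp only [Finset.mem_coe, Finset.mem_sdiff, some_mem_tee]
        omega
      · simp only [Finset.mem_coe, Finset.mem_sdiff, some_mem_tee]
        omega

lemma csgMove_tee_empty {N a b : ℕ} (h : a + b + 2 ≤ N) :
    CsgMove spider (Set.Icc 1 N) (tee a b) ∅ :=
  csgMove_of_sdiff_eq (by simp) Finset.sdiff_empty (connOn_tee a b) (by simpa using h) (Or.inl rfl)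

lemma csgMove_tee_seg {N a b : ℕ} (hN : 1 ≤ N) :
    CsgMove spider (Set.Icc 1 N) (tee a b) (seg (-a) (b + 1)) := by
  refine csgMove_of_sdiff_eq (u := {none}) (Finset.subset_insert _ _) ?_ connOn_singleton_none
    (by simpa using hN) (Or.inr (connOn_seg (by omega)))
  ext (_ | i)
  · simp
  · simp [tee]

lemma csgMove_tee_seg_left {N a b j : ℕ} (hj : 1 ≤ j) (hja : j ≤ a) (hN : a + b + 2 ≤ j + N) :
    CsgMove spider (Set.Icc 1 N) (tee a b) (seg (-a) (-a + j)) := by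
  refine csgMove_of_sdiff_eq (u := tee (a - j) b) ?_ ?_ (connOn_tee _ _) ?_
    (Or.inr (connOn_seg (by omega)))
  · rintro (_ | i) hi
    · simp
    · rw [some_mem_seg] at hi
      rw [some_mem_tee]
      omega
  · ext (_ | i)
    · simp
    · simp only [Finset.mem_sdiff, some_mem_seg, some_mem_tee]
      omega
  · rw [card_tee]
    omega

lemma csgMove_tee_left {N a a' b : ℕ} (h : a' < a) (hN : a ≤ a' + N) :
    CsgMove spider (Set.Icc 1 N) (tee a b) (tee a' b) := by
  refine csgMove_of_sdiff_eq (u := seg (-a) (-a')) ?_ ?_ (connOn_seg (by omega)) ?_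
    (Or.inr (connOn_tee _ _))
  · rintro (_ | i) hi
    · simp
    · rw [some_mem_tee] at hi ⊢
      omega
  · ext (_ | i)
    · simp
    · simp only [Finset.mem_sdiff, some_mem_seg, some_mem_tee]
      omega
  · rw [card_seg]
    omega

lemma csgMove_tee_right {N a b b' : ℕ} (h : b' < b) (hN : b ≤ b' + N) :
    CsgMove spider (Set.Icc 1 N) (tee a b) (tee a b') := by
  refine csgMove_of_sdiff_eq (u := seg (b' + 1) (b + 1)) ?_ ?_ (connOn_seg (by omega)) ?_
    (Or.inr (connOn_tee _ _))
  · rintro (_ | i) hi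
    · simp
    · rw [some_mem_tee] at hi ⊢
      omega
  · ext (_ | i)
    · simp
    · simp only [Finset.mem_sdiff, some_mem_seg, some_mem_tee]
      omega
  · rw [card_seg]
    omega

/-- The reflection of `spider` about its centre. -/
def spiderNeg : spider ↪g spider where
  toFun := Option.map Neg.neg
  inj' := Option.map_injective neg_injective
  map_rel_iff' := by
    rintro (_ | i) (_ | j)
    · simp
    · simp [spider_adj_none_some]
    · simp [spider_adj_some_none]
    · simp only [Function.Embedding.coeFn_mk, Option.map_some, spider_adj_some_some]
      omega

lemma csgGrundy_tee_comm (L : Set ℕ) (a b : ℕ) :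
    csgGrundy spider L (tee a b) = csgGrundy spider L (tee b a) := by
  rw [csgGrundy_map spiderNeg]
  congr 1
  ext x
  simp only [Finset.mem_map]
  constructor
  · rintro ⟨_ | i, hi, rfl⟩
    · exact none_mem_tee _ _
    · change some (-i) ∈ _
      rw [some_mem_tee] at hi ⊢
      omega
  · cases x with
    | none => exact fun _ => ⟨none, none_mem_tee _ _, rfl⟩
    | some i =>
      intro hi
      refine ⟨some (-i), ?_, congrArg some (neg_neg i)⟩
      rw [some_mem_tee] at hi ⊢
      omega

/-- The claimed Grundy value of `S(1, k, l)`. -/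
def teeValue (N k l : ℕ) : ℕ :=
  if k + l ≤ N - 2 ∧ k % 2 = 1 ∧ l % 2 = 1 then k + l
  else if k + l ≤ N - 2 ∧ k = l ∧ k ≠ 0 ∧ k % 2 = 0 then k + 1
  else (k + l + 2) % (N + 1)

lemma teeValue_comm (N k l : ℕ) : teeValue N k l = teeValue N l k := by
  simp only [teeValue]
  rw [Nat.add_comm k l]
  split_ifs <;> omega

/-- The case distinction of `teeValue` without the modulus. -/
lemma teeValue_eq {N k l : ℕ} (hN : 3 ≤ N) (hk : k ≤ N - 1) (hl : l ≤ N - 1) :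
    teeValue N k l =
      if N + 1 ≤ k + l + 2 then k + l + 2 - (N + 1)
      else if k + l ≤ N - 2 ∧ k % 2 = 1 ∧ l % 2 = 1 then k + l
      else if k + l ≤ N - 2 ∧ k = l ∧ k ≠ 0 ∧ k % 2 = 0 then k + 1
      else k + l + 2 := by
  rw [teeValue]
  by_cases h : N + 1 ≤ k + l + 2
  · rw [if_neg (by omega), if_neg (by omega), if_pos h, Nat.mod_eq_sub_mod h,
      Nat.mod_eq_of_lt (by omega)]
  · rw [if_neg h, Nat.mod_eq_of_lt (show k + l + 2 < N + 1 by omega)]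

lemma csgGrundy_tee (N : ℕ) (hN : 3 ≤ N) (k l : ℕ) (hk : k ≤ N - 1) (hl : l ≤ N - 1) :
    csgGrundy spider (Set.Icc 1 N) (tee k l) = teeValue N k l := by
  induction hn : k + l using Nat.strong_induction_on generalizing k l with
  | _ n ih =>
  subst hn
  wlog hlk : l ≤ k generalizing k l with H
  · rw [csgGrundy_tee_comm, teeValue_comm]
    refine H l k hl hk (fun m hm a b ha hb hab => ?_) (by omega)
    exact ih m (by omega) a b ha hb hab
  have hleft (k' : ℕ) (h : k' < k) := ih (k' + l) (by omega) k' l (by omega) hl rfl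
  have hright (l' : ℕ) (h : l' < l) := ih (k + l') (by omega) k l' hk (by omega) rfl
  have hfull : csgGrundy spider (Set.Icc 1 N) (seg (-k) (l + 1)) =
      if N ≤ k + l then k + l - N else k + l + 1 := by
    rw [csgGrundy_seg, show ((l : ℤ) + 1 - -(k : ℤ)).toNat = k + l + 1 by omega]
    split_ifs with h
    · rw [Nat.mod_eq_sub_mod (by omega), Nat.mod_eq_of_lt (by omega)]
      omega
    · exact Nat.mod_eq_of_lt (by omega)
  refine csgGrundy_eq_of (fun t ht => ?_) fun v hv => ?_
  · rw [teeValue_eq hN hk hl]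
    rcases ht.of_tee with ⟨rfl, h⟩ | ⟨rfl, h⟩ | rfl | ⟨c, d, rfl, hcd, hj, hle⟩ | ⟨k', h, rfl⟩ |
      ⟨l', h, rfl⟩
    · rw [csgGrundy_empty]
      split_ifs <;> omega
    · rw [csgGrundy_singleton_none (by omega)]
      split_ifs <;> omega
    · rw [hfull]
      split_ifs <;> omega
    · rw [csgGrundy_seg, Nat.mod_eq_of_lt (by omega)]
      split_ifs <;> omega
    · rw [hleft k' h, teeValue_eq hN (by omega) hl]
      split_ifs <;> omega
    · rw [hright l' h, teeValue_eq hN hk (by omega)]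
      split_ifs <;> omega
  rw [teeValue_eq hN hk hl] at hv
  have useLeft (k' : ℕ) (h : k' < k) (hval : teeValue N k' l = v) :
      ∃ t, CsgMove spider (Set.Icc 1 N) (tee k l) t ∧ csgGrundy spider (Set.Icc 1 N) t = v :=
    ⟨tee k' l, csgMove_tee_left h (by omega), (hleft k' h).trans hval⟩
  have useRight (l' : ℕ) (h : l' < l) (hval : teeValue N k l' = v) :
      ∃ t, CsgMove spider (Set.Icc 1 N) (tee k l) t ∧ csgGrundy spider (Set.Icc 1 N) t = v :=
    ⟨tee k l', csgMove_tee_right h (by omega), (hright l' h).trans hval⟩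
  by_cases hbig : N + 1 ≤ k + l + 2
  · rw [if_pos hbig] at hv
    refine useLeft (N - 1 - l + v) (by omega) ?_
    rw [teeValue_eq hN (by omega) hl, if_pos (by omega)]
    omega
  rw [if_neg hbig] at hv
  rcases Nat.eq_zero_or_pos v with rfl | hv0
  · exact ⟨∅, csgMove_tee_empty (by omega), csgGrundy_empty N⟩
  by_cases hvk : v ≤ k
  · refine ⟨_, csgMove_tee_seg_left hv0 hvk (by omega), ?_⟩
    rw [csgGrundy_seg, Nat.mod_eq_of_lt (by omega)]
    omega
  by_cases hvt : v = k + l + 1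
  · refine ⟨_, csgMove_tee_seg (by omega), ?_⟩
    rw [hfull, if_neg (by omega), hvt]
  have hvle : v ≤ k + l := by
    split_ifs at hv <;> omega
  rcases Nat.mod_two_eq_zero_or_one k with hk2 | hk2
  · by_cases hv1 : v = k + 1
    · have hne : k ≠ l := by
        rintro rfl
        split_ifs at hv <;> omega
      refine useLeft (k - l - 1) (by omega) ?_
      rw [teeValue_eq hN (by omega) hl, if_neg (by omega), if_neg (by omega), if_neg (by omega)]
      omega
    · refine useRight (v - k - 2) (by omega) ?_
      rw [teeValue_eq hN hk (by omega), if_neg (by omega), if_neg (by omega), if_neg (by omega)]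
      omega
  · rcases Nat.mod_two_eq_zero_or_one v with hv2 | hv2
    · refine useRight (v - k) (by split_ifs at hv <;> omega) ?_
      rw [teeValue_eq hN hk (by omega), if_neg (by omega), if_pos (by omega)]
      omega
    · refine useRight (v - k - 2) (by omega) ?_
      rw [teeValue_eq hN hk (by omega), if_neg (by omega), if_neg (by omega), if_neg (by omega)]
      omega

/-- The embedding of `S(1, k, l)` in `spider`, centre at `0`. -/
def starToSpider (k l : ℕ) : subdividedStar ![1, k, l] ↪g spider where
  toFun
    | none => some 0
    | some ⟨i, j⟩ => if i = 0 then none else if i = 1 then some (-(j : ℤ) - 1) else some (j + 1)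
  inj' := by
    rintro (_ | ⟨i, j⟩) (_ | ⟨i', j'⟩) h
    · rfl
    · fin_cases i' <;> simp at h <;> omega
    · fin_cases i <;> simp at h <;> omega
    · have hj : i = 0 → (j : ℕ) = 0 := by
        rintro rfl
        exact Nat.lt_one_iff.1 j.2
      have hj' : i' = 0 → (j' : ℕ) = 0 := by
        rintro rfl
        exact Nat.lt_one_iff.1 j'.2
      have hii : i = i' := by
        fin_cases i <;> fin_cases i' <;> simp at h ⊢ <;> omega
      subst hii
      have hjj : j = j' := by
        rw [Fin.ext_iff]
        fin_cases i <;> simp at h hj hj' ⊢ <;> omega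
      rw [hjj]
  map_rel_iff' := by
    rintro (_ | ⟨i, j⟩) (_ | ⟨i', j'⟩)
    · simp
    · have hj' : i' = 0 → (j' : ℕ) = 0 := by
        rintro rfl
        exact Nat.lt_one_iff.1 j'.2
      fin_cases i' <;> simp [spider_adj_some_some, spider_adj_some_none, subdividedStar] at hj' ⊢ <;>
        omega
    · have hj : i = 0 → (j : ℕ) = 0 := by
        rintro rfl
        exact Nat.lt_one_iff.1 j.2
      fin_cases i <;> simp [spider_adj_some_some, spider_adj_none_some, subdividedStar] at hj ⊢ <;>
        omega
    · have hj : i = 0 → (j : ℕ) = 0 := by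
        rintro rfl
        exact Nat.lt_one_iff.1 j.2
      have hj' : i' = 0 → (j' : ℕ) = 0 := by
        rintro rfl
        exact Nat.lt_one_iff.1 j'.2
      by_cases hii : i = i'
      · subst hii
        have hjj : j = j' ↔ (j : ℕ) = j' := Fin.ext_iff
        simp only [subdividedStar, SimpleGraph.fromRel_adj, ne_eq, Option.some.injEq,
          Sigma.mk.injEq, heq_eq_eq, true_and, hjj]
        fin_cases i <;> simp [spider_adj_some_some] at hj hj' ⊢ <;> omega
      · fin_cases i <;> fin_cases i' <;>
          simp [spider_adj_some_some, spider_adj_some_none, spider_adj_none_some,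
            subdividedStar] at hii hj hj' ⊢ <;>
          omega

lemma map_starToSpider_univ (k l : ℕ) :
    Finset.univ.map (starToSpider k l).toEmbedding = tee k l := by
  ext x
  simp only [Finset.mem_map, Finset.mem_univ, true_and]
  constructor
  · rintro ⟨_ | ⟨i, j⟩, rfl⟩
    · change some 0 ∈ _
      simp
    · have hj := j.2
      fin_cases i
      · exact none_mem_tee k l
      · change some (-(j : ℤ) - 1) ∈ _
        change (j : ℕ) < k at hj
        rw [some_mem_tee]
        omega
      · change some ((j : ℤ) + 1) ∈ _
        change (j : ℕ) < l at hj
        rw [some_mem_tee]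
        omega
  · cases x with
    | none => exact fun _ => ⟨some ⟨0, (0 : Fin 1)⟩, rfl⟩
    | some i =>
      intro hi
      rw [some_mem_tee] at hi
      rcases lt_trichotomy i 0 with h | rfl | h
      · refine ⟨some ⟨1, (⟨(-i - 1).toNat, by omega⟩ : Fin k)⟩, ?_⟩
        change some (-((-i - 1).toNat : ℤ) - 1) = some i
        congr 1
        omega
      · exact ⟨none, rfl⟩
      · refine ⟨some ⟨2, (⟨(i - 1).toNat, by omega⟩ : Fin l)⟩, ?_⟩
        change some (((i - 1).toNat : ℤ) + 1) = some i
        congr 1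
        omega

/-- Grundy values of the subdivided star S(1,k,l) for CSG({1,…,N}), N ≥ 3,
when k, l ≤ N - 1. -/
theorem stmt10 (N k l : ℕ) (hN : 3 ≤ N) (hk : k ≤ N - 1) (hl : l ≤ N - 1) :
    csgGrundy (subdividedStar ![1, k, l]) (Set.Icc 1 N) Finset.univ =
      if k + l ≤ N - 2 ∧ k % 2 = 1 ∧ l % 2 = 1 then k + l
      else if k + l ≤ N - 2 ∧ k = l ∧ k ≠ 0 ∧ k % 2 = 0 then k + 1
      else (k + l + 2) % (N + 1) := by
  rw [csgGrundy_map (starToSpider k l), map_starToSpider_univ, csgGrundy_tee N hN k l hk hl]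
  rfl
end

section
/- For the game CSG({1,2,3}) played on subdivided stars, the Grundy value of S(ℓ₁,...,ℓ_t) equals the Grundy value of S(ℓ₁ mod 4, ..., ℓ_t mod 4), for all t ≥ 0 and all ℓ₁,...,ℓ_t ≥ 0. -/
open SimpleGraph

lemma mex_eq_of {s : Set ℕ} {v : ℕ} (h₁ : v ∉ s) (h₂ : ∀ u < v, u ∈ s) : mex s = v :=
  le_antisymm (Nat.sInf_le h₁) (le_csInf ⟨v, h₁⟩ fun u hu => by
    by_contra! hlt
    exact hu (h₂ u hlt))

lemma mem_of_lt_mex {s : Set ℕ} {u : ℕ} (h : u < mex s) : u ∈ s := by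
  simpa using Nat.notMem_of_lt_sInf h

lemma mex_notMem {s : Set ℕ} (hs : s.Finite) : mex s ∉ s :=
  Nat.sInf_mem (s := {n | n ∉ s}) hs.exists_notMem

section StarGrundy

variable {ι : Type*} [Fintype ι] [DecidableEq ι]

lemma sum_update_add (m : ι → ℕ) (i : ι) (c : ℕ) :
    ∑ x, Function.update m i c x + m i = ∑ x, m x + c := by
  rw [Finset.sum_update_of_mem (Finset.mem_univ i),
    ← Finset.add_sum_erase Finset.univ m (Finset.mem_univ i), Finset.sdiff_singleton_eq_erase]
  ring

/-- The Grundy value of a subdivided star with at least one (possibly empty) branch, in terms of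
the branch lengths only. Either a branch `i` is shortened to length `c`, or the center is removed
and a path on `q` vertices of branch `i` remains. -/
noncomputable def starGrundy (m : ι → ℕ) : ℕ :=
  mex ({v | ∃ i c, ∃ _ : c < m i ∧ m i ≤ c + 3, v = starGrundy (Function.update m i c)} ∪
    {v | ∃ i q, q ≤ m i ∧ ∑ x, m x ≤ q + 2 ∧ v = q % 4})
termination_by ∑ x, m x
decreasing_by
  have := sum_update_add m i c
  omega

/-- The Grundy values of the options of a subdivided star. -/
def starOptions (m : ι → ℕ) : Set ℕ :=
  {v | (∃ i c, c < m i ∧ m i ≤ c + 3 ∧ v = starGrundy (Function.update m i c)) ∨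
    ∃ i q, q ≤ m i ∧ ∑ x, m x ≤ q + 2 ∧ v = q % 4}

lemma starGrundy_eq_mex (m : ι → ℕ) : starGrundy m = mex (starOptions m) := by
  rw [starGrundy]
  congr 1
  ext v
  simp [starOptions, and_assoc]

lemma starOptions_finite (m : ι → ℕ) : (starOptions m).Finite := by
  refine ((Set.finite_range fun x : (i : ι) × Fin (m i) =>
    starGrundy (Function.update m x.1 x.2)).union (Set.finite_Iio 4)).subset ?_
  rintro v (⟨i, c, h, -, rfl⟩ | ⟨i, q, -, -, rfl⟩)
  · exact Or.inl ⟨⟨i, c, h⟩, rfl⟩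
  · exact Or.inr (Nat.mod_lt _ (by norm_num))

lemma starGrundy_update_ne {m : ι → ℕ} {i : ι} {c : ℕ} (h₁ : c < m i) (h₂ : m i ≤ c + 3) :
    starGrundy (Function.update m i c) ≠ starGrundy m := by
  intro h
  refine mex_notMem (starOptions_finite m) ?_
  rw [← starGrundy_eq_mex, ← h]
  exact Or.inl ⟨i, c, h₁, h₂, rfl⟩

/-- If all branches but one have at most two vertices in total, the star behaves like a path. -/
lemma starGrundy_eq_mod (m : ι → ℕ) (j : ι) (hj : ∑ x, m x ≤ m j + 2) :
    starGrundy m = (∑ x, m x + 1) % 4 := by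
  induction hn : ∑ x, m x using Nat.strong_induction_on generalizing m with
  | _ n ih =>
  have key : ∀ i c, c < m i → starGrundy (Function.update m i c) = (n + c - m i + 1) % 4 := by
    intro i c hc
    have hs := sum_update_add m i c
    have hle : m i ≤ ∑ x, m x := Finset.single_le_sum (f := m) (by simp) (Finset.mem_univ i)
    rw [ih (∑ x, Function.update m i c x) (by omega) (Function.update m i c) ?_ rfl]
    · congr 1
      omega
    · by_cases hij : j = i
      · subst hij
        rw [Function.update_self]
        omega
      · rw [Function.update_of_ne hij]
        omega
  have hle : ∀ i, m i ≤ n := fun i =>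
    hn ▸ Finset.single_le_sum (f := m) (by simp) (Finset.mem_univ i)
  rw [starGrundy_eq_mex]
  apply mex_eq_of
  · rintro (⟨i, c, h₁, h₂, h⟩ | ⟨i, q, h₁, h₂, h⟩)
    · rw [key i c h₁] at h
      have := hle i
      omega
    · have := hle i
      omega
  · intro u hu
    have := hle j
    obtain ⟨k, hk⟩ : ∃ k, (n + 1) % 4 = u + k := ⟨(n + 1) % 4 - u, by omega⟩
    by_cases h₁ : k ≤ m j
    · refine Or.inl ⟨j, m j - k, by omega, by omega, ?_⟩
      rw [key j _ (by omega)]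
      omega
    · by_cases h₂ : n + 1 - k ≤ m j
      · exact Or.inr ⟨j, n + 1 - k, h₂, by omega, by omega⟩
      · obtain ⟨b, hb⟩ : ∃ b, 0 < m b := by
          by_contra! h
          have : ∑ x, m x = 0 := Finset.sum_eq_zero fun x _ => by simpa using h x
          omega
        have := hle b
        by_cases hk1 : k = 1
        · refine Or.inl ⟨b, m b - 1, by omega, by omega, ?_⟩
          rw [key b _ (by omega)]
          omega
        · exact Or.inr ⟨b, 1, by omega, by omega, by omega⟩

lemma starGrundy_update_add_four (m : ι → ℕ) (i : ι) :
    starGrundy (Function.update m i (m i + 4)) = starGrundy m := by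
  induction hn : ∑ x, m x using Nat.strong_induction_on generalizing m with
  | _ n ih =>
  have hs := sum_update_add m i (m i + 4)
  by_cases hi : n ≤ m i + 2
  · rw [starGrundy_eq_mod m i (by omega), starGrundy_eq_mod _ i (by
      rw [Function.update_self]; omega)]
    omega
  have ih' : ∀ j c, c < m j → starGrundy (Function.update (Function.update m i (m i + 4)) j
      (if j = i then c + 4 else c)) = starGrundy (Function.update m j c) := by
    intro j c hc
    have hs := sum_update_add m j c
    have := ih _ (by omega) (Function.update m j c) rfl
    split_ifs with hji
    · subst hji
      simpa using this
    · rwa [Function.update_of_ne (Ne.symm hji), Function.update_comm hji] at this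
  rw [starGrundy_eq_mex]
  apply mex_eq_of
  · rintro (⟨j, c, h₁, h₂, h⟩ | ⟨j, q, h₁, h₂, -⟩)
    · by_cases hji : j = i
      · subst hji
        rw [Function.update_self] at h₁ h₂
        by_cases hc : 4 ≤ c
        · have := ih' j (c - 4) (by omega)
          rw [if_pos rfl, Nat.sub_add_cancel hc, ← h] at this
          exact starGrundy_update_ne (by omega) (by omega) this.symm
        · rw [Function.update_idem] at h
          refine starGrundy_update_ne (m := Function.update m j c) (i := j) (c := m j)
            ?_ ?_ ?_
          · rw [Function.update_self]; omega
          · rw [Function.update_self]; omega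
          · simpa using h
      · rw [Function.update_of_ne hji] at h₁ h₂
        have := ih' j c h₁
        rw [if_neg hji, ← h] at this
        exact starGrundy_update_ne h₁ h₂ this.symm
    · by_cases hji : j = i
      · subst hji
        rw [Function.update_self] at h₁
        omega
      · rw [Function.update_of_ne hji] at h₁
        have : m i + m j ≤ ∑ x, m x := by
          rw [← Finset.sum_pair (f := m) (Ne.symm hji)]
          exact Finset.sum_le_sum_of_subset (Finset.subset_univ _)
        omega
  · intro u hu
    have shorten : ∀ j c, c < m j → m j ≤ c + 3 → starGrundy (Function.update m j c) = u →
        u ∈ starOptions (Function.update m i (m i + 4)) := by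
      intro j c h₁ h₂ h
      refine Or.inl ⟨j, if j = i then c + 4 else c, ?_, ?_, ?_⟩
      · split_ifs with hji
        · subst hji
          simpa using h₁
        · rwa [Function.update_of_ne hji]
      · split_ifs with hji
        · subst hji
          simp only [Function.update_self]
          omega
        · rwa [Function.update_of_ne hji]
      · rw [ih' j c h₁, h]
    rcases mem_of_lt_mex (starGrundy_eq_mex m ▸ hu) with ⟨j, c, h₁, h₂, h⟩ | ⟨j, q, h₁, h₂, h⟩
    · exact shorten j c h₁ h₂ h.symm
    · rw [starGrundy_eq_mod m j (by omega)] at hu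
      have hji : j ≠ i := by
        rintro rfl
        omega
      obtain ⟨k, hk⟩ : ∃ k, (n + 1) % 4 = u + k := ⟨(n + 1) % 4 - u, by omega⟩
      have hs' := sum_update_add m j (m j - k)
      refine shorten j (m j - k) (by omega) (by omega) ?_
      rw [starGrundy_eq_mod _ j (by rw [Function.update_self]; omega)]
      omega

lemma starGrundy_mod_four (m : ι → ℕ) : starGrundy m = starGrundy fun i => m i % 4 := by
  induction hn : ∑ x, m x using Nat.strong_induction_on generalizing m with
  | _ n ih =>
  by_cases h : ∃ i, 4 ≤ m i
  · obtain ⟨i, hi⟩ := h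
    have hs := sum_update_add m i (m i - 4)
    have h₁ := starGrundy_update_add_four (Function.update m i (m i - 4)) i
    rw [Function.update_self, Function.update_idem, Nat.sub_add_cancel hi,
      Function.update_eq_self] at h₁
    rw [h₁, ih _ (by omega) _ rfl]
    congr 1
    funext j
    by_cases hji : j = i
    · subst hji
      rw [Function.update_self]
      omega
    · rw [Function.update_of_ne hji]
  · push Not at h
    congr 1
    funext i
    exact (Nat.mod_eq_of_lt (h i)).symm

end StarGrundy

lemma csgGrundy_eq_mex {V : Type*} [DecidableEq V] (G : SimpleGraph V) (L : Set ℕ)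
    (s : Finset V) :
    csgGrundy G L s = mex {v | ∃ t, CsgMove G L s t ∧ v = csgGrundy G L t} := by
  rw [csgGrundy]
  congr 1
  ext v
  simp [eq_comm]

lemma ConnOn.exists_adj {V : Type*} {G : SimpleGraph V} {s : Set V} (h : ConnOn G s)
    (P : V → Prop) {x y : V} (hx : x ∈ s) (hy : y ∈ s) (hPx : P x) (hPy : ¬ P y) :
    ∃ u ∈ s, ∃ v ∈ s, G.Adj u v ∧ P u ∧ ¬ P v := by
  obtain ⟨w⟩ := h.preconnected ⟨x, hx⟩ ⟨y, hy⟩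
  obtain ⟨d, -, h₁, h₂⟩ := w.exists_boundary_dart {z | P z} hPx hPy
  exact ⟨d.fst, d.fst.2, d.snd, d.snd.2, d.adj, h₁, h₂⟩

section Star

variable {t : ℕ} {l : Fin t → ℕ}

lemma subdividedStar_adj_none_some {i : Fin t} {j : Fin (l i)} :
    (subdividedStar l).Adj none (some ⟨i, j⟩) ↔ (j : ℕ) = 0 := by
  simp [subdividedStar]

lemma subdividedStar_adj_some_some {i i' : Fin t} {j : Fin (l i)} {j' : Fin (l i')} :
    (subdividedStar l).Adj (some ⟨i, j⟩) (some ⟨i', j'⟩) ↔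
      i = i' ∧ ((j : ℕ) + 1 = j' ∨ (j' : ℕ) + 1 = j) := by
  simp only [subdividedStar, SimpleGraph.fromRel_adj, ne_eq, Option.some.injEq, Fin.val_inj]
  constructor
  · rintro ⟨-, ⟨rfl, h⟩ | ⟨rfl, h⟩⟩
    · exact ⟨rfl, Or.inl h⟩
    · exact ⟨rfl, Or.inr h⟩
  · rintro ⟨rfl, h⟩
    refine ⟨?_, h.imp (⟨rfl, ·⟩) (⟨rfl, ·⟩)⟩
    intro heq
    simp only [Sigma.mk.injEq, heq_eq_eq, true_and] at heq
    subst heq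
    omega

/-- The center together with the first `m i` vertices of each branch `i`. -/
def subStar (l m : Fin t → ℕ) : Finset (Option (Σ i : Fin t, Fin (l i))) :=
  Finset.insertNone (Finset.univ.sigma fun i => Finset.univ.filter fun j => (j : ℕ) < m i)

/-- The vertices of branch `i` at positions in `[a, b)`. -/
def branchSegment (l : Fin t → ℕ) (i : Fin t) (a b : ℕ) :
    Finset (Option (Σ i : Fin t, Fin (l i))) :=
  (Finset.univ.sigma fun i' => Finset.univ.filter fun j : Fin (l i') =>
    i' = i ∧ a ≤ (j : ℕ) ∧ (j : ℕ) < b).map Function.Embedding.some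

@[simp] lemma none_mem_subStar {m : Fin t → ℕ} : none ∈ subStar l m := by
  simp [subStar]

@[simp] lemma some_mem_subStar {m : Fin t → ℕ} {i : Fin t} {j : Fin (l i)} :
    some ⟨i, j⟩ ∈ subStar l m ↔ (j : ℕ) < m i := by
  simp [subStar]

@[simp] lemma none_notMem_branchSegment {i : Fin t} {a b : ℕ} : none ∉ branchSegment l i a b := by
  simp [branchSegment]

@[simp] lemma some_mem_branchSegment {i i' : Fin t} {j : Fin (l i')} {a b : ℕ} :
    some ⟨i', j⟩ ∈ branchSegment l i a b ↔ i' = i ∧ a ≤ (j : ℕ) ∧ (j : ℕ) < b := by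
  simp [branchSegment]

lemma card_subStar {m : Fin t → ℕ} (hm : m ≤ l) : (subStar l m).card = ∑ i, m i + 1 := by
  rw [subStar, Finset.card_insertNone, Finset.card_sigma]
  congr 1
  refine Finset.sum_congr rfl fun i _ => ?_
  rw [Fin.card_filter_val_lt]
  exact min_eq_right (hm i)

lemma subStar_subset_subStar {m m' : Fin t → ℕ} (h : m' ≤ m) : subStar l m' ⊆ subStar l m := by
  rintro (_ | ⟨i, j⟩) hx
  · simp
  · rw [some_mem_subStar] at hx ⊢
    exact hx.trans_le (h i)

lemma branchSegment_subset_subStar {m : Fin t → ℕ} {i : Fin t} {a b : ℕ} (hb : b ≤ m i) :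
    branchSegment l i a b ⊆ subStar l m := by
  rintro (_ | ⟨i', j⟩) hx
  · simp
  · rw [some_mem_branchSegment] at hx
    obtain ⟨rfl, -, h⟩ := hx
    rw [some_mem_subStar]
    omega

lemma update_le_of_le {m : Fin t → ℕ} {i : Fin t} {c : ℕ} (h : c ≤ m i) :
    Function.update m i c ≤ m :=
  update_le_iff.2 ⟨h, fun _ _ => le_rfl⟩

lemma subStar_sdiff_subStar (m : Fin t → ℕ) (i : Fin t) (c : ℕ) :
    subStar l m \ subStar l (Function.update m i c) = branchSegment l i c (m i) := by
  ext (_ | ⟨i', j⟩)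
  · simp
  · by_cases h : i' = i
    · subst h
      simp [and_comm]
    · simp [h]

lemma subStar_sdiff_branchSegment {m : Fin t → ℕ} {i : Fin t} {c : ℕ} (hc : c ≤ m i) :
    subStar l m \ branchSegment l i c (m i) = subStar l (Function.update m i c) := by
  rw [← subStar_sdiff_subStar, Finset.sdiff_sdiff_eq_self]
  exact subStar_subset_subStar (update_le_of_le hc)

lemma card_branchSegment {i : Fin t} {a b : ℕ} (hb : b ≤ l i) (hab : a ≤ b) :
    (branchSegment l i a b).card = b - a := by
  have h := subStar_sdiff_subStar (l := l) (Function.update 0 i b) i a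
  rw [Function.update_idem, Function.update_self] at h
  have hle : Function.update (0 : Fin t → ℕ) i b ≤ l := by
    rw [update_le_iff]
    exact ⟨hb, fun _ _ => Nat.zero_le _⟩
  have hle' : Function.update (0 : Fin t → ℕ) i a ≤ Function.update (0 : Fin t → ℕ) i b := by
    rw [update_le_update_iff]
    exact ⟨hab, fun _ _ => le_rfl⟩
  have h₁ := sum_update_add (0 : Fin t → ℕ) i a
  have h₂ := sum_update_add (0 : Fin t → ℕ) i b
  rw [← h, Finset.card_sdiff_of_subset (subStar_subset_subStar hle'), card_subStar hle,
    card_subStar (hle'.trans hle)]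
  simp only [Pi.zero_apply, Finset.sum_const_zero] at h₁ h₂
  omega

lemma connOn_subStar {m : Fin t → ℕ} :
    ConnOn (subdividedStar l) (↑(subStar l m) : Set (Option (Σ i : Fin t, Fin (l i)))) := by
  refine (SimpleGraph.connected_iff_exists_forall_reachable _).2 ⟨⟨none, by simp⟩, ?_⟩
  rintro ⟨_ | ⟨i, j, hj⟩, hx⟩
  · rfl
  · induction j with
    | zero =>
      apply SimpleGraph.Adj.reachable
      simp [subdividedStar_adj_none_some]
    | succ j ih =>
      have hx' : j + 1 < m i := by simpa using hx
      have hmem : some ⟨i, j, by omega⟩ ∈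
          (↑(subStar l m) : Set (Option (Σ i : Fin t, Fin (l i)))) := by
        simp only [Finset.mem_coe, some_mem_subStar]
        omega
      refine (ih (by omega) hmem).trans (SimpleGraph.Adj.reachable ?_)
      simp [subdividedStar_adj_some_some]

lemma connOn_branchSegment {i : Fin t} {a b : ℕ} (hab : a < b) (hb : b ≤ l i) :
    ConnOn (subdividedStar l) (↑(branchSegment l i a b) :
      Set (Option (Σ i : Fin t, Fin (l i)))) := by
  refine (SimpleGraph.connected_iff_exists_forall_reachable _).2
    ⟨⟨some ⟨i, a, by omega⟩, by simpa using hab⟩, ?_⟩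
  rintro ⟨_ | ⟨i', j, hj⟩, hx⟩
  · simp at hx
  · obtain ⟨rfl, haj, hjb⟩ : i' = i ∧ a ≤ j ∧ j < b := by simpa using hx
    induction j, haj using Nat.le_induction with
    | base => rfl
    | succ j haj ih =>
      have hmem : some ⟨i', j, by omega⟩ ∈
          (↑(branchSegment l i' a b) : Set (Option (Σ i : Fin t, Fin (l i)))) := by
        simp only [Finset.mem_coe, some_mem_branchSegment, true_and]
        omega
      refine (ih (by omega) hmem (by omega)).trans (SimpleGraph.Adj.reachable ?_)
      simp [subdividedStar_adj_some_some]

lemma ConnOn.some_mem_of_le {s : Set (Option (Σ i : Fin t, Fin (l i)))}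
    (h : ConnOn (subdividedStar l) s) (hs : none ∈ s) {i : Fin t} {a b : Fin (l i)}
    (hb : some ⟨i, b⟩ ∈ s) (hab : (a : ℕ) ≤ b) : some ⟨i, a⟩ ∈ s := by
  by_contra ha
  have hne : (a : ℕ) ≠ b := fun h => ha (Fin.ext h ▸ hb)
  obtain ⟨u, hu, v, hv, hadj, ⟨c, rfl, hc⟩, hPv⟩ := h.exists_adj
    (fun x => ∃ c : Fin (l i), x = some ⟨i, c⟩ ∧ (a : ℕ) < c) hb hs ⟨b, rfl, by omega⟩ (by simp)
  rcases v with _ | ⟨i', c'⟩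
  · rw [SimpleGraph.adj_comm, subdividedStar_adj_none_some] at hadj
    omega
  · rw [subdividedStar_adj_some_some] at hadj
    obtain ⟨rfl, hadj⟩ := hadj
    have h₁ : ¬ (a : ℕ) < c' := fun h => hPv ⟨c', rfl, h⟩
    have h₂ : a = c' := Fin.ext (by omega)
    exact ha (h₂ ▸ hv)

lemma ConnOn.eq_branchSegment {s : Finset (Option (Σ i : Fin t, Fin (l i)))}
    (h : ConnOn (subdividedStar l) (↑s : Set (Option (Σ i : Fin t, Fin (l i)))))
    (hs : none ∉ s) : ∃ i a b, a < b ∧ b ≤ l i ∧ s = branchSegment l i a b := by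
  obtain ⟨⟨x, hx⟩⟩ := h.nonempty
  rcases x with _ | ⟨i, j⟩
  · exact absurd hx hs
  have hbranch : ∀ i' (j' : Fin (l i')), some ⟨i', j'⟩ ∈ s → i' = i := by
    intro i' j' hj'
    by_contra hne
    obtain ⟨u, hu, v, hv, hadj, ⟨c, rfl⟩, hPv⟩ := h.exists_adj
      (fun x => ∃ c : Fin (l i), x = some ⟨i, c⟩) hx hj' ⟨j, rfl⟩ (by
        rintro ⟨c, hc⟩
        simp only [Option.some.injEq, Sigma.mk.injEq] at hc
        exact hne hc.1)
    rcases v with _ | ⟨i'', c'⟩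
    · exact hs hv
    · rw [subdividedStar_adj_some_some] at hadj
      obtain ⟨rfl, -⟩ := hadj
      exact hPv ⟨c', rfl⟩
  have hconv : ∀ a b c : Fin (l i), some ⟨i, a⟩ ∈ s → some ⟨i, c⟩ ∈ s → (a : ℕ) ≤ b →
      (b : ℕ) ≤ c → some ⟨i, b⟩ ∈ s := by
    intro a b c ha hc hab hbc
    by_contra hb
    have hne : a ≠ b := fun h => hb (h ▸ ha)
    have hne' : (a : ℕ) ≠ b := fun h => hne (Fin.ext h)
    obtain ⟨u, hu, v, hv, hadj, ⟨d, rfl, hd⟩, hPv⟩ := h.exists_adj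
      (fun x => ∃ d : Fin (l i), x = some ⟨i, d⟩ ∧ (d : ℕ) < b) ha hc ⟨a, rfl, by omega⟩ (by
        rintro ⟨d, hd, hdb⟩
        simp only [Option.some.injEq, Sigma.mk.injEq, heq_eq_eq, true_and] at hd
        subst hd
        omega)
    rcases v with _ | ⟨i', d'⟩
    · exact hs hv
    · rw [subdividedStar_adj_some_some] at hadj
      obtain ⟨rfl, hadj⟩ := hadj
      have h₁ : ¬ (d' : ℕ) < b := fun h => hPv ⟨d', rfl, h⟩
      have h₂ : d' = b := Fin.ext (by omega)
      exact hb (h₂ ▸ hv)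
  let T : Finset (Fin (l i)) := Finset.univ.filter fun j => some ⟨i, j⟩ ∈ s
  have hT : T.Nonempty := ⟨j, by simpa [T] using hx⟩
  have hmin : some ⟨i, T.min' hT⟩ ∈ s := (Finset.mem_filter.1 (T.min'_mem hT)).2
  have hmax : some ⟨i, T.max' hT⟩ ∈ s := (Finset.mem_filter.1 (T.max'_mem hT)).2
  refine ⟨i, T.min' hT, T.max' hT + 1, ?_, (T.max' hT).2, ?_⟩
  · exact Nat.lt_succ_of_le (T.min'_le _ (T.max'_mem hT))
  · ext (_ | ⟨i', j'⟩)
    · simpa using hs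
    · rw [some_mem_branchSegment]
      constructor
      · intro hj'
        obtain rfl := hbranch _ _ hj'
        have hmem : j' ∈ T := by simpa [T] using hj'
        exact ⟨rfl, T.min'_le _ hmem, Nat.lt_succ_of_le (T.le_max' _ hmem)⟩
      · rintro ⟨rfl, h₁, h₂⟩
        exact hconv _ _ _ hmin hmax h₁ (Nat.le_of_lt_succ h₂)

lemma branchSegment_self (i : Fin t) (a : ℕ) : branchSegment l i a a = ∅ := by
  ext (_ | ⟨i', j⟩)
  · simp
  · simp

lemma branchSegment_eq_empty_or_connOn {i : Fin t} {a b : ℕ} (hab : a ≤ b) (hb : b ≤ l i) :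
    branchSegment l i a b = ∅ ∨
      ConnOn (subdividedStar l) (↑(branchSegment l i a b) :
      Set (Option (Σ i : Fin t, Fin (l i)))) := by
  rcases hab.eq_or_lt with rfl | h
  · exact Or.inl (branchSegment_self i a)
  · exact Or.inr (connOn_branchSegment h hb)

lemma csgGrundy_path {s : Finset (Option (Σ i : Fin t, Fin (l i)))}
    (h : s = ∅ ∨ ConnOn (subdividedStar l) (↑s : Set (Option (Σ i : Fin t, Fin (l i)))))
    (hs : none ∉ s) : csgGrundy (subdividedStar l) {1, 2, 3} s = s.card % 4 := by
  induction hn : s.card using Nat.strong_induction_on generalizing s with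
  | _ n ih =>
  rw [csgGrundy_eq_mex]
  apply mex_eq_of
  · rintro ⟨r, ⟨hrs, -, hk, -, hr⟩, h⟩
    have hle := Finset.card_le_card hrs
    simp only [Finset.card_sdiff_of_subset hrs, Set.mem_insert_iff, Set.mem_singleton_iff] at hk
    rw [ih r.card (by omega) hr (fun h => hs (hrs h)) rfl] at h
    omega
  · intro u hu
    rcases h with rfl | h
    · simp at hn
      omega
    obtain ⟨i, a, b, hab, hb, rfl⟩ := h.eq_branchSegment hs
    rw [card_branchSegment hb hab.le] at hn
    obtain ⟨k, hk⟩ : ∃ k, n % 4 = u + k := ⟨n % 4 - u, by omega⟩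
    have hsub : branchSegment l i a (b - k) ⊆ branchSegment l i a b := by
      rintro (_ | ⟨i', j⟩)
      · simp
      · simp only [some_mem_branchSegment]
        omega
    have hdiff : branchSegment l i a b \ branchSegment l i a (b - k) =
        branchSegment l i (b - k) b := by
      ext (_ | ⟨i', j⟩)
      · simp
      · simp only [Finset.mem_sdiff, some_mem_branchSegment]
        omega
    have hcard := card_branchSegment (l := l) (i := i) (a := b - k) hb (by omega)
    have hconn := branchSegment_eq_empty_or_connOn (l := l) (i := i) (a := a) (b := b - k)
      (by omega) (by omega)
    refine ⟨branchSegment l i a (b - k), ⟨hsub, ?_, ?_, ?_, hconn⟩, ?_⟩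
    · rw [hdiff, ← Finset.card_pos]
      omega
    · rw [hdiff, hcard]
      simp only [Set.mem_insert_iff, Set.mem_singleton_iff]
      omega
    · rw [hdiff]
      exact connOn_branchSegment (by omega) hb
    · have hcard' := card_branchSegment (l := l) (i := i) (a := a) (b := b - k) (by omega) (by omega)
      rw [ih _ (by omega) hconn (by simp) rfl, hcard']
      omega

lemma le_of_branchSegment_subset {m : Fin t → ℕ} {i : Fin t} {a b : ℕ} (hab : a < b) (hb : b ≤ l i)
    (h : branchSegment l i a b ⊆ subStar l m) : b ≤ m i := by
  have := @h (some ⟨i, b - 1, by omega⟩) (by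
    simp only [some_mem_branchSegment, true_and]
    omega)
  rw [some_mem_subStar] at this
  simp only at this
  omega

lemma CsgMove.eq_subStar {m : Fin t → ℕ} (hm : m ≤ l)
    {r : Finset (Option (Σ i : Fin t, Fin (l i)))}
    (h : CsgMove (subdividedStar l) {1, 2, 3} (subStar l m) r) (hr : none ∈ r) :
    ∃ i c, c < m i ∧ m i ≤ c + 3 ∧ r = subStar l (Function.update m i c) := by
  obtain ⟨hsub, -, hk, hdiff, hconn⟩ := h
  replace hconn := hconn.resolve_left (Finset.ne_empty_of_mem hr)
  obtain ⟨i, a, b, hab, hb, heq⟩ := hdiff.eq_branchSegment (by simp [hr])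
  have hbm : b ≤ m i := le_of_branchSegment_subset hab hb (heq ▸ Finset.sdiff_subset)
  obtain rfl : b = m i := by
    by_contra hne
    have hlt : b < m i := by omega
    have hbr : some ⟨i, b, hlt.trans_le (hm i)⟩ ∈ r := by
      by_contra hbr
      have : some ⟨i, b, hlt.trans_le (hm i)⟩ ∈ subStar l m \ r := by
        simpa [hbr] using hlt
      simp [heq] at this
    have har : some ⟨i, a, by omega⟩ ∈ r :=
      hconn.some_mem_of_le hr hbr hab.le
    have : some ⟨i, a, by omega⟩ ∈ subStar l m \ r := by
      rw [heq]
      simpa using hab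
    exact (Finset.mem_sdiff.1 this).2 har
  refine ⟨i, a, hab, ?_, ?_⟩
  · rw [heq, card_branchSegment hb hab.le] at hk
    simp only [Set.mem_insert_iff, Set.mem_singleton_iff] at hk
    omega
  · rw [← subStar_sdiff_branchSegment hab.le, ← heq, Finset.sdiff_sdiff_eq_self hsub]

lemma csgMove_subStar_update {m : Fin t → ℕ} (hm : m ≤ l) {i : Fin t} {c : ℕ} (h₁ : c < m i)
    (h₂ : m i ≤ c + 3) : CsgMove (subdividedStar l) {1, 2, 3} (subStar l m)
      (subStar l (Function.update m i c)) := by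
  have hcard := card_branchSegment (hm i) h₁.le
  refine ⟨subStar_subset_subStar (update_le_of_le h₁.le), ?_, ?_, ?_, Or.inr connOn_subStar⟩
  · rw [subStar_sdiff_subStar, ← Finset.card_pos]
    omega
  · rw [subStar_sdiff_subStar, hcard]
    simp only [Set.mem_insert_iff, Set.mem_singleton_iff]
    omega
  · rw [subStar_sdiff_subStar]
    exact connOn_branchSegment h₁ (hm i)

lemma csgMove_branchSegment {m : Fin t → ℕ} (hm : m ≤ l) {i : Fin t} {q : ℕ} (h₁ : q ≤ m i)
    (h₂ : ∑ x, m x ≤ q + 2) : CsgMove (subdividedStar l) {1, 2, 3} (subStar l m)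
      (branchSegment l i (m i - q) (m i)) := by
  have hdiff := subStar_sdiff_branchSegment (l := l) (m := m) (i := i) (c := m i - q) (by omega)
  have hsum := sum_update_add m i (m i - q)
  have hle : Function.update m i (m i - q) ≤ m := update_le_of_le (by omega)
  refine ⟨branchSegment_subset_subStar le_rfl, ?_, ?_, ?_,
    branchSegment_eq_empty_or_connOn (by omega) (hm i)⟩
  · rw [hdiff]
    exact ⟨none, by simp⟩
  · rw [hdiff, card_subStar (hle.trans hm)]
    simp only [Set.mem_insert_iff, Set.mem_singleton_iff]
    omega
  · rw [hdiff]
    exact connOn_subStar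

lemma csgGrundy_subStar [Nonempty (Fin t)] (m : Fin t → ℕ) (hm : m ≤ l) :
    csgGrundy (subdividedStar l) {1, 2, 3} (subStar l m) = starGrundy m := by
  induction hn : ∑ x, m x using Nat.strong_induction_on generalizing m with
  | _ n ih =>
  have key : ∀ i c, c < m i → csgGrundy (subdividedStar l) {1, 2, 3}
      (subStar l (Function.update m i c)) = starGrundy (Function.update m i c) := by
    intro i c hc
    have hs := sum_update_add m i c
    exact ih _ (by omega) _ ((update_le_of_le hc.le).trans hm) rfl
  rw [csgGrundy_eq_mex, starGrundy_eq_mex]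
  congr 1
  ext v
  constructor
  · rintro ⟨r, hr, rfl⟩
    by_cases hnr : none ∈ r
    · obtain ⟨i, c, h₁, h₂, rfl⟩ := hr.eq_subStar hm hnr
      exact Or.inl ⟨i, c, h₁, h₂, key i c h₁⟩
    · obtain ⟨hsub, -, hk, -, hconn⟩ := hr
      rw [csgGrundy_path hconn hnr]
      have hle := Finset.card_le_card hsub
      rw [Finset.card_sdiff_of_subset hsub] at hk
      simp only [card_subStar hm, Set.mem_insert_iff, Set.mem_singleton_iff] at hk hle
      rcases hconn with rfl | hconn
      · rw [Finset.card_empty] at hk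
        exact Or.inr ⟨Classical.arbitrary _, 0, Nat.zero_le _, by omega, rfl⟩
      · obtain ⟨i, a, b, hab, hb, rfl⟩ := hconn.eq_branchSegment hnr
        have hbm := le_of_branchSegment_subset hab hb hsub
        rw [card_branchSegment hb hab.le] at hk ⊢
        exact Or.inr ⟨i, b - a, by omega, by omega, rfl⟩
  · rintro (⟨i, c, h₁, h₂, rfl⟩ | ⟨i, q, h₁, h₂, rfl⟩)
    · exact ⟨_, csgMove_subStar_update hm h₁ h₂, (key i c h₁).symm⟩
    · refine ⟨_, csgMove_branchSegment hm h₁ h₂, ?_⟩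
      rw [csgGrundy_path (branchSegment_eq_empty_or_connOn (by omega) (hm i)) (by simp),
        card_branchSegment (hm i) (by omega)]
      congr 1
      omega

lemma subStar_self (l : Fin t → ℕ) : subStar l l = Finset.univ := by
  ext (_ | ⟨i, j⟩) <;> simp

end Star

/-- For CSG({1,2,3}) on subdivided stars, all branch lengths can be reduced
mod 4 without changing the Grundy value. -/
theorem stmt14 (t : ℕ) (l : Fin t → ℕ) :
    csgGrundy (subdividedStar l) ({1, 2, 3} : Set ℕ) Finset.univ =
    csgGrundy (subdividedStar fun i => l i % 4) ({1, 2, 3} : Set ℕ)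
      Finset.univ := by 
  rcases isEmpty_or_nonempty (Fin t) with h | h
  · suffices ∀ l', csgGrundy (subdividedStar l) ({1, 2, 3} : Set ℕ) Finset.univ =
        csgGrundy (subdividedStar l') ({1, 2, 3} : Set ℕ) Finset.univ from this _
    intro l'
    rw [Subsingleton.elim l' l]
  · rw [← subStar_self, ← subStar_self, csgGrundy_subStar _ le_rfl, csgGrundy_subStar _ le_rfl,
      starGrundy_mod_four]
end
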